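/- Let k be a positive integer and let G and G' be Gauss diagrams such that G' is obtained from G by adding or removing k consecutive shell-pairs, all of the same sign ε (4k consecutive chord endpoints forming k shell-pairs of sign ε placed one after another). Then G and G' are related by a finite sequence of 2k-moves, Ξ-moves and Reidemeister moves. -/

import Mathlib

/-!
Combinatorial Gauss diagrams.

A Gauss diagram is encoded as a list of chord endpoints read along the
oriented circle from a basepoint.  Each endpoint records the (natural number)
label of its chord, whether it is the terminal endpoint of the (oriented)
chord, and the sign of the chord (`true` = +1, `false` = -1).
Diagrams are considered up to rotation of the basepoint and relabeling of the
chords; these renamings are included among the "Reidemeister" generators.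
-/

structure Endpoint where
  label : ℕ
  isTerminal : Bool
  sign : Bool
deriving DecidableEq

namespace Gauss

/-- The sign (±1) of the chord through an endpoint. -/
def signValue (e : Endpoint) : ℤ := if e.sign then 1 else -1

/-- The sign assigned to an endpoint: `ε` at the terminal endpoint and `-ε`
at the initial endpoint of a chord of sign `ε`. -/
def endpointValue (e : Endpoint) : ℤ := if e.isTerminal then signValue e else -signValue e

/-- The list of chord labels of the endpoints of a word. -/
def labels (L : List Endpoint) : List ℕ := L.map Endpoint.label

/-- A word is a Gauss diagram when every chord label occurring in it occurs
exactly twice, once as an initial and once as a terminal endpoint, with the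
same sign at both occurrences. -/
def IsGaussDiagram (L : List Endpoint) : Prop :=
  ∀ e ∈ L, (L.filter (fun x => x.label == e.label)).length = 2 ∧
    ∃ e' ∈ L, e'.label = e.label ∧ e'.isTerminal = !e.isTerminal ∧ e'.sign = e.sign

/-- Rotate a word so that the first endpoint satisfying `p` comes first. -/
def rotateTo (L : List Endpoint) (p : Endpoint → Bool) : List Endpoint :=
  match L.findIdx? p with
  | some i => L.drop i ++ L.take i
  | none => L

/-- The index of the chord labeled `c`: the sum of the signs assigned to the
endpoints on the arc running from the initial endpoint of the chord to its
terminal endpoint in the direction of the circle's orientation. -/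
def chordIndex (L : List Endpoint) (c : ℕ) : ℤ :=
  ((((rotateTo L (fun e => e.label == c && !e.isTerminal)).drop 1).takeWhile
      (fun e => e.label != c)).map endpointValue).sum

/-- `Jn L n`: the sum of the signs of the chords of `L` of index `n`. -/
def Jn (L : List Endpoint) (n : ℤ) : ℤ :=
  ((L.filter (fun e => e.isTerminal && decide (chordIndex L e.label = n))).map signValue).sum

/-- The odd writhe: the sum of the signs of the chords of odd index,
i.e. `J = Σ_{n odd} J_n`. -/
def oddWrithe (L : List Endpoint) : ℤ :=
  ((L.filter (fun e => e.isTerminal && decide (chordIndex L e.label % 2 ≠ 0))).map signValue).sum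

/-- Moving the basepoint of the circle. -/
def rotateStep (L L' : List Endpoint) : Prop :=
  ∃ x xs, L = x :: xs ∧ L' = xs ++ [x]

/-- Injective relabeling of the chords. -/
def relabelStep (L L' : List Endpoint) : Prop :=
  ∃ f : ℕ → ℕ, Function.Injective f ∧
    L' = L.map (fun e => Endpoint.mk (f e.label) e.isTerminal e.sign)

/-- Reidemeister move I (removal direction): remove an isolated chord whose
two endpoints are adjacent (either orientation, either sign). -/
def reid1 (L L' : List Endpoint) : Prop :=
  ∃ (A B : List Endpoint) (c : ℕ) (t s : Bool),
    c ∉ labels (A ++ B) ∧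
    L = A ++ [Endpoint.mk c t s, Endpoint.mk c (!t) s] ++ B ∧
    L' = A ++ B

/-- Reidemeister move II (removal direction): remove two chords of opposite
signs whose initial endpoints are adjacent and whose terminal endpoints are
adjacent (in either of the two admissible orders). -/
def reid2 (L L' : List Endpoint) : Prop :=
  ∃ (A B C : List Endpoint) (c d : ℕ) (s crossed : Bool),
    c ≠ d ∧ c ∉ labels (A ++ B ++ C) ∧ d ∉ labels (A ++ B ++ C) ∧
    L = A ++ [Endpoint.mk c false s, Endpoint.mk d false (!s)] ++ B ++
        (if crossed then [Endpoint.mk c true s, Endpoint.mk d true (!s)]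
         else [Endpoint.mk d true (!s), Endpoint.mk c true s]) ++ C ∧
    L' = A ++ B ++ C

/-- Reidemeister move III (a standard variant; together with the moves I, II,
rotations and relabelings it generates all versions of the third move). -/
def reid3 (L L' : List Endpoint) : Prop :=
  ∃ (A B C D : List Endpoint) (a b c : ℕ) (s : Bool),
    a ≠ b ∧ b ≠ c ∧ a ≠ c ∧
    L = A ++ [Endpoint.mk b false s, Endpoint.mk a false s] ++ B ++
        [Endpoint.mk a true s, Endpoint.mk c false (!s)] ++ C ++
        [Endpoint.mk b true s, Endpoint.mk c true (!s)] ++ D ∧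
    L' = A ++ [Endpoint.mk a false s, Endpoint.mk b false s] ++ B ++
        [Endpoint.mk c false (!s), Endpoint.mk a true s] ++ C ++
        [Endpoint.mk c true (!s), Endpoint.mk b true s] ++ D

/-- A single Reidemeister generator (including diagram renamings). -/
def reidStep (L L' : List Endpoint) : Prop :=
  rotateStep L L' ∨ relabelStep L L' ∨ reid1 L L' ∨ reid2 L L' ∨ reid3 L L'

/-- A Ξ-move: exchange the first and third of three consecutive endpoints
belonging to three distinct chords, keeping all signs and orientations. -/
def xiStep (L L' : List Endpoint) : Prop :=
  ∃ (A B : List Endpoint) (x y z : Endpoint),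
    x.label ≠ y.label ∧ y.label ≠ z.label ∧ x.label ≠ z.label ∧
    L = A ++ [x, y, z] ++ B ∧
    L' = A ++ [z, y, x] ++ B

/-- A 2k-move (removal direction): remove `2k` chords `c 0, …, c (2k-1)`, all
of sign `s`, whose `p`-endpoints appear consecutively on one arc and whose
`q`-endpoints appear consecutively on a disjoint arc, the chord `c i` being
oriented from `p` to `q` for even `i` (the paper's odd `i`, 1-indexed) and
from `q` to `p` for odd `i`, so initial and terminal endpoints alternate. -/
def move2k (k : ℕ) (L L' : List Endpoint) : Prop :=
  ∃ (A B C : List Endpoint) (c : ℕ → ℕ) (s : Bool),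
    (∀ i < 2 * k, ∀ j < 2 * k, c i = c j → i = j) ∧
    (∀ i < 2 * k, c i ∉ labels (A ++ B ++ C)) ∧
    L = A ++ (List.range (2 * k)).map (fun i => Endpoint.mk (c i) (decide (i % 2 = 1)) s)
          ++ B ++
        (List.range (2 * k)).map (fun i => Endpoint.mk (c i) (decide (i % 2 = 0)) s)
          ++ C ∧
    L' = A ++ B ++ C

/-- A crossing change: reverse the sign and the orientation of one chord. -/
def crossingChange (L L' : List Endpoint) : Prop :=
  ∃ c : ℕ,
    L' = L.map (fun e =>
      if e.label = c then Endpoint.mk e.label (!e.isTerminal) (!e.sign) else e)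

/-- Finite sequences of moves from `r`, performed in either direction. -/
def Moves (r : List Endpoint → List Endpoint → Prop) :
    List Endpoint → List Endpoint → Prop :=
  Relation.ReflTransGen (fun L L' => r L L' ∨ r L' L)

/-- Related by Reidemeister moves: the two words represent the same virtual knot. -/
def ReidEquiv : List Endpoint → List Endpoint → Prop := Moves reidStep

/-- Related by a finite sequence of 2k-moves (and Reidemeister moves). -/
def Rel2k (k : ℕ) : List Endpoint → List Endpoint → Prop :=
  Moves (fun L L' => reidStep L L' ∨ move2k k L L')

/-- Related by a finite sequence of Ξ-moves (and Reidemeister moves). -/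
def RelXi : List Endpoint → List Endpoint → Prop :=
  Moves (fun L L' => reidStep L L' ∨ xiStep L L')

/-- Related by a finite sequence of 2k-moves and Ξ-moves (and Reidemeister moves). -/
def Rel2kXi (k : ℕ) : List Endpoint → List Endpoint → Prop :=
  Moves (fun L L' => reidStep L L' ∨ move2k k L L' ∨ xiStep L L')

/-- Related by a finite sequence of crossing changes and Ξ-moves
(and Reidemeister moves). -/
def RelCCXi : List Endpoint → List Endpoint → Prop :=
  Moves (fun L L' => reidStep L L' ∨ crossingChange L L' ∨ xiStep L L')

/-- A shell-pair of sign `s`: two chords `c`, `d` of sign `s` whose four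
endpoints are consecutive, interleaved as 1st-3rd and 2nd-4th
(with arbitrary orientations `t`, `u` of the two shells). -/
def shellPair (c d : ℕ) (t u s : Bool) : List Endpoint :=
  [Endpoint.mk c t s, Endpoint.mk d u s, Endpoint.mk c (!t) s, Endpoint.mk d (!u) s]

/-- The Gauss diagram `G(a)`: `|a|` consecutive shell-pairs of sign `+1` if
`a > 0` and of sign `-1` if `a < 0`; `G(0)` has no chords.  It represents the
virtual knot `K(a)`. -/
def Gword (a : ℤ) : List Endpoint :=
  ((List.range a.natAbs).map
    (fun j => shellPair (2 * j) (2 * j + 1) false false (decide (0 < a)))).flatten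

/-- `Rel2kCount k m G G'`: `G` and `G'` are related by a finite sequence of
Reidemeister moves and exactly `m` 2k-moves. -/
inductive Rel2kCount (k : ℕ) : ℕ → List Endpoint → List Endpoint → Prop
  | refl (L : List Endpoint) : Rel2kCount k 0 L L
  | reid {m : ℕ} {L L' L'' : List Endpoint} :
      reidStep L L' ∨ reidStep L' L →
      Rel2kCount k m L' L'' → Rel2kCount k m L L''
  | move {m : ℕ} {L L' L'' : List Endpoint} :
      move2k k L L' ∨ move2k k L' L →
      Rel2kCount k m L' L'' → Rel2kCount k (m + 1) L L''

/-- The 2k-move distance: the minimal number of 2k-moves needed to relate the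
two diagrams (together with Reidemeister moves). -/
noncomputable def dist2k (k : ℕ) (L L' : List Endpoint) : ℕ :=
  sInf {m | Rel2kCount k m L L'}

end Gauss

namespace Gauss

/-- The one-directional generator relation used in `Rel2kXi`. -/
def genStep (k : ℕ) (L L' : List Endpoint) : Prop :=
  reidStep L L' ∨ move2k k L L' ∨ xiStep L L'

theorem rel_refl (k : ℕ) (L : List Endpoint) : Rel2kXi k L L := Relation.ReflTransGen.refl

theorem rel_trans {k : ℕ} {L M N : List Endpoint} (h : Rel2kXi k L M) (h' : Rel2kXi k M N) :
    Rel2kXi k L N := Relation.ReflTransGen.trans h h'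

theorem rel_of_step {k : ℕ} {L M : List Endpoint} (h : genStep k L M) : Rel2kXi k L M :=
  Relation.ReflTransGen.single (Or.inl h)

theorem rel_of_step_rev {k : ℕ} {L M : List Endpoint} (h : genStep k M L) : Rel2kXi k L M :=
  Relation.ReflTransGen.single (Or.inr h)

theorem rel_symm {k : ℕ} {L M : List Endpoint} (h : Rel2kXi k L M) : Rel2kXi k M L := by
  unfold Rel2kXi Moves at *
  induction h with
  | refl => exact Relation.ReflTransGen.refl
  | tail _ h ih => exact Relation.ReflTransGen.head h.symm ih

theorem rel_rotate (k : ℕ) (X Y : List Endpoint) : Rel2kXi k (X ++ Y) (Y ++ X) := by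
  induction X generalizing Y with
  | nil => simpa using rel_refl k Y
  | cons x X ih =>
    have h1 : Rel2kXi k (x :: X ++ Y) (X ++ (Y ++ [x])) :=
      rel_of_step (Or.inl (Or.inl ⟨x, X ++ Y, by simp, by simp⟩))
    have h2 := ih (Y ++ [x])
    exact rel_trans h1 (by simpa using h2)

theorem rel_xi (k : ℕ) (A B : List Endpoint) (x y z : Endpoint)
    (h1 : x.label ≠ y.label) (h2 : y.label ≠ z.label) (h3 : x.label ≠ z.label) :
    Rel2kXi k (A ++ [x, y, z] ++ B) (A ++ [z, y, x] ++ B) :=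
  rel_of_step (Or.inr (Or.inr ⟨A, B, x, y, z, h1, h2, h3, rfl, rfl⟩))

/-- Two adjacent endpoints pass through a word of even length by Ξ-moves. -/
theorem rel_block (k : ℕ) (a b : Endpoint) (hab : a.label ≠ b.label) (n : ℕ) :
    ∀ (A W B : List Endpoint), W.length = 2 * n → a.label ∉ labels W → b.label ∉ labels W →
    Rel2kXi k (A ++ [a, b] ++ W ++ B) (A ++ W ++ [a, b] ++ B) := by
  induction n with
  | zero =>
    intro A W B hW _ _
    have : W = [] := List.length_eq_zero_iff.mp (by simpa using hW)
    subst this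
    simpa using rel_refl k _
  | succ n ih =>
    intro A W B hW ha hb
    match W, hW with
    | w :: v :: W, hW =>
      simp only [labels, List.map_cons, List.mem_cons, not_or] at ha hb
      obtain ⟨ha1, ha2, ha3⟩ := ha
      obtain ⟨hb1, hb2, hb3⟩ := hb
      have s1 := rel_xi k A (v :: W ++ B) a b w hab hb1 ha1
      have s2 := rel_xi k (A ++ [w]) (W ++ B) b a v hab.symm ha2 hb2
      have s3 := ih (A ++ [w, v]) W B (by simp at hW; omega) ha3 hb3
      simp only [List.append_assoc, List.cons_append, List.nil_append] at s1 s2 s3 ⊢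
      exact rel_trans s1 (rel_trans s2 s3)

/-- The orientation of a shell can be reversed. -/
theorem rel_flip (k : ℕ) (A B : List Endpoint) (c : ℕ) (t s : Bool) (x : Endpoint)
    (hx : x.label ≠ c) (hA : c ∉ labels A) (hB : c ∉ labels B)
    (hpar : (A.length + B.length) % 2 = 1) :
    Rel2kXi k (A ++ [Endpoint.mk c t s, x, Endpoint.mk c (!t) s] ++ B)
      (A ++ [Endpoint.mk c (!t) s, x, Endpoint.mk c t s] ++ B) := by
  obtain ⟨y, hy⟩ := Infinite.exists_notMem_finset
    ((c :: x.label :: (labels A ++ labels B)).toFinset)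
  simp only [List.mem_toFinset, List.mem_cons, List.mem_append, not_or] at hy
  obtain ⟨hyc, hyx, hyA, hyB⟩ := hy
  set c1 := Endpoint.mk c t s with hc1
  set c2 := Endpoint.mk c (!t) s with hc2
  have l1 : c1.label = c := rfl
  have l2 : c2.label = c := rfl
  set y1 := Endpoint.mk y false s with hy1
  set y2 := Endpoint.mk y true s with hy2
  have m1 : y1.label = y := rfl
  have m2 : y2.label = y := rfl
  have r1 : Rel2kXi k (A ++ [c1, x, c2] ++ B) ([c1, x, c2] ++ (B ++ A)) := by
    have := rel_rotate k A ([c1, x, c2] ++ B)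
    simpa using this
  have r2 : Rel2kXi k ([c2, x, c1] ++ (B ++ A)) (A ++ [c2, x, c1] ++ B) := by
    have := rel_rotate k ([c2, x, c1] ++ B) A
    simpa using this
  refine rel_trans r1 (rel_trans ?_ r2)
  obtain ⟨w, W, hW⟩ : ∃ w W, B ++ A = w :: W := by
    cases h : B ++ A with
    | nil =>
      have := congrArg List.length h
      simp only [List.length_append, List.length_nil] at this
      omega
    | cons w W => exact ⟨w, W, rfl⟩
  have hcW : c ∉ labels (w :: W) := by
    rw [← hW]; simp only [labels, List.map_append, List.mem_append, not_or]
    exact ⟨hB, hA⟩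
  have hyW : y ∉ labels (w :: W) := by
    rw [← hW]; simp only [labels, List.map_append, List.mem_append, not_or]
    exact ⟨hyB, hyA⟩
  have hlen : W.length % 2 = 0 := by
    have := congrArg List.length hW
    simp only [List.length_append, List.length_cons] at this
    omega
  rw [hW]
  clear r1 r2 hW
  have hcW' := hcW
  have hyW' := hyW
  simp only [labels, List.map_cons, List.mem_cons, not_or] at hcW' hyW'
  have s1 : Rel2kXi k ([c1, x, c2] ++ (w :: W)) ([c1, x, y2, y1, c2] ++ (w :: W)) := by
    refine rel_of_step_rev (Or.inl (Or.inr (Or.inr (Or.inl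
      ⟨[c1, x], c2 :: w :: W, y, true, s, ?_, by simp [hy1, hy2], by simp⟩))))
    simp only [labels, List.map_cons, List.cons_append, List.nil_append, List.mem_cons, not_or]
    exact ⟨hyc, hyx, hyc, hyW'.1, hyW'.2⟩
  have s2 := rel_xi k [c1, x, y2] W y1 c2 w hyc hcW'.1 hyW'.1
  have s3 := rel_block k c2 y1 (Ne.symm hyc) (W.length / 2) [c1, x, y2, w] W []
    (by omega) hcW'.2 hyW'.2
  have s4 := rel_rotate k ([c1, x, y2, w] ++ W) [c2, y1]
  have s5 := rel_xi k [c2, y1] (w :: W) c1 x y2 (Ne.symm hx) (Ne.symm hyx) (Ne.symm hyc)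
  have s6 : Rel2kXi k ([c2, y1, y2, x, c1] ++ (w :: W)) ([c2, x, c1] ++ (w :: W)) := by
    refine rel_of_step (Or.inl (Or.inr (Or.inr (Or.inl
      ⟨[c2], x :: c1 :: w :: W, y, false, s, ?_, by simp [hy1, hy2], by simp⟩))))
    simp only [labels, List.map_cons, List.cons_append, List.nil_append, List.mem_cons, not_or]
    exact ⟨hyc, hyx, hyc, hyW'.1, hyW'.2⟩
  simp only [List.append_assoc, List.cons_append, List.nil_append, List.append_nil]
    at s1 s2 s3 s4 s5 s6 ⊢
  exact rel_trans s1 (rel_trans s2 (rel_trans s3 (rel_trans s4 (rel_trans s5 s6))))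

/-- The orientations of a shell-pair can be prescribed. -/
theorem rel_pair (k : ℕ) (A B : List Endpoint) (c d : ℕ) (t u t' u' s : Bool)
    (hcd : c ≠ d) (hcA : c ∉ labels A) (hcB : c ∉ labels B)
    (hdA : d ∉ labels A) (hdB : d ∉ labels B)
    (hpar : (A.length + B.length) % 2 = 0) :
    Rel2kXi k (A ++ shellPair c d t u s ++ B) (A ++ shellPair c d t' u' s ++ B) := by
  have h1 : Rel2kXi k (A ++ shellPair c d t u s ++ B) (A ++ shellPair c d t' u s ++ B) := by
    by_cases h : t' = t
    · subst h; exact rel_refl k _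
    · have ht : t' = !t := by cases t <;> cases t' <;> simp_all
      subst ht
      have := rel_flip k A (Endpoint.mk d (!u) s :: B) c t s (Endpoint.mk d u s) hcd.symm hcA
        (by simp only [labels, List.map_cons, List.mem_cons, not_or]; exact ⟨hcd, hcB⟩)
        (by simp only [List.length_cons]; omega)
      simpa [shellPair] using this
  have h2 : Rel2kXi k (A ++ shellPair c d t' u s ++ B) (A ++ shellPair c d t' u' s ++ B) := by
    by_cases h : u' = u
    · subst h; exact rel_refl k _
    · have hu : u' = !u := by cases u <;> cases u' <;> simp_all
      subst hu
      have := rel_flip k (A ++ [Endpoint.mk c t' s]) B d u s (Endpoint.mk c (!t') s) hcd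
        (by
          simp only [labels, List.map_append, List.map_cons, List.map_nil, List.mem_append,
            List.mem_singleton, not_or]
          exact ⟨hdA, hcd.symm⟩)
        hdB (by simp only [List.length_append, List.length_singleton]; omega)
      simpa [shellPair] using this
  exact rel_trans h1 h2

/-- `n` consecutive shell-pairs. -/
def shells (c : ℕ → ℕ) (t : ℕ → Bool) (s : Bool) (n : ℕ) : List Endpoint :=
  ((List.range n).map (fun i =>
    shellPair (c (2 * i)) (c (2 * i + 1)) (t (2 * i)) (t (2 * i + 1)) s)).flatten

theorem shells_succ (c : ℕ → ℕ) (t : ℕ → Bool) (s : Bool) (n : ℕ) :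
    shells c t s (n + 1) = shells c t s n ++
      shellPair (c (2 * n)) (c (2 * n + 1)) (t (2 * n)) (t (2 * n + 1)) s := by
  simp [shells, List.range_succ]

theorem length_shells (c : ℕ → ℕ) (t : ℕ → Bool) (s : Bool) (n : ℕ) :
    (shells c t s n).length = 4 * n := by
  induction n with
  | zero => simp [shells]
  | succ n ih => rw [shells_succ, List.length_append, ih]; simp [shellPair]; omega

theorem mem_labels_shells (c : ℕ → ℕ) (t : ℕ → Bool) (s : Bool) (n x : ℕ)
    (h : x ∈ labels (shells c t s n)) : ∃ i < 2 * n, x = c i := by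
  induction n with
  | zero => simp [shells, labels] at h
  | succ n ih =>
    rw [shells_succ] at h
    simp only [labels, List.map_append, List.mem_append] at h
    rcases h with h | h
    · obtain ⟨i, hi, e⟩ := ih h
      exact ⟨i, by omega, e⟩
    · simp only [shellPair, List.map_cons, List.map_nil, List.mem_cons, List.not_mem_nil,
        or_false] at h
      rcases h with h | h | h | h
      · exact ⟨2 * n, by omega, h⟩
      · exact ⟨2 * n + 1, by omega, h⟩
      · exact ⟨2 * n, by omega, h⟩
      · exact ⟨2 * n + 1, by omega, h⟩

theorem rel_shells (k : ℕ) (c : ℕ → ℕ) (t t' : ℕ → Bool) (s : Bool) (n : ℕ) :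
    ∀ (A B : List Endpoint),
    (∀ i < 2 * n, ∀ j < 2 * n, c i = c j → i = j) →
    (∀ i < 2 * n, c i ∉ labels A) → (∀ i < 2 * n, c i ∉ labels B) →
    (A.length + B.length) % 2 = 0 →
    Rel2kXi k (A ++ shells c t s n ++ B) (A ++ shells c t' s n ++ B) := by
  induction n with
  | zero => intro A B _ _ _ _; simpa [shells] using rel_refl k _
  | succ n ih =>
    intro A B hinj hA hB hpar
    have hne : ∀ i < 2 * (n + 1), ∀ j < 2 * (n + 1), i ≠ j → c i ≠ c j :=
      fun i hi j hj hij e => hij (hinj i hi j hj e)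
    have h1 := ih A (shellPair (c (2 * n)) (c (2 * n + 1)) (t (2 * n)) (t (2 * n + 1)) s ++ B)
      (fun i hi j hj => hinj i (by omega) j (by omega)) (fun i hi => hA i (by omega))
      (by
        intro i hi
        simp only [labels, shellPair, List.cons_append, List.nil_append, List.map_cons,
          List.mem_cons, not_or]
        have a1 := hne i (by omega) (2 * n) (by omega) (by omega)
        have a2 := hne i (by omega) (2 * n + 1) (by omega) (by omega)
        exact ⟨a1, a2, a1, a2, hB i (by omega)⟩)
      (by simp only [shellPair, List.length_append, List.length_cons, List.length_nil]; omega)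
    have hfr : ∀ i, 2 * n ≤ i → i < 2 * (n + 1) → c i ∉ labels (A ++ shells c t' s n) := by
      intro i hi hi' hm
      simp only [labels, List.map_append, List.mem_append] at hm
      rcases hm with hm | hm
      · exact hA i hi' hm
      · obtain ⟨j, hj, e⟩ := mem_labels_shells c t' s n _ hm
        exact hne i hi' j (by omega) (by omega) e
    have h2 := rel_pair k (A ++ shells c t' s n) B (c (2 * n)) (c (2 * n + 1))
      (t (2 * n)) (t (2 * n + 1)) (t' (2 * n)) (t' (2 * n + 1)) s
      (hne _ (by omega) _ (by omega) (by omega))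
      (hfr _ (by omega) (by omega)) (hB _ (by omega))
      (hfr _ (by omega) (by omega)) (hB _ (by omega))
      (by rw [List.length_append, length_shells]; omega)
    rw [shells_succ, shells_succ]
    simp only [List.append_assoc] at h1 h2 ⊢
    exact rel_trans h1 h2

/-- One of the two arcs of a 2n-move. -/
def arc (c : ℕ → ℕ) (r : ℕ) (s : Bool) (n : ℕ) : List Endpoint :=
  (List.range (2 * n)).map (fun i => Endpoint.mk (c i) (decide (i % 2 = r)) s)

theorem arc_succ (c : ℕ → ℕ) (r : ℕ) (s : Bool) (n : ℕ) :
    arc c r s (n + 1) = arc c r s n ++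
      [Endpoint.mk (c (2 * n)) (decide (0 = r)) s,
       Endpoint.mk (c (2 * n + 1)) (decide (1 = r)) s] := by
  have e : 2 * (n + 1) = 2 * n + 1 + 1 := by ring
  have h1 : (2 * n + 1) % 2 = 1 := by omega
  simp [arc, e, List.range_succ, h1]

theorem mem_labels_arc (c : ℕ → ℕ) (r : ℕ) (s : Bool) (n x : ℕ)
    (h : x ∈ labels (arc c r s n)) : ∃ i < 2 * n, x = c i := by
  simp only [labels, arc, List.map_map, List.mem_map, List.mem_range, Function.comp] at h
  obtain ⟨i, hi, e⟩ := h
  exact ⟨i, hi, e.symm⟩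

/-- Shell-pairs with alternating orientations are obtained from the chords of a 2n-move with
consecutive arcs by Ξ-moves. -/
theorem rel_arcs (k : ℕ) (c : ℕ → ℕ) (s : Bool) (n : ℕ) :
    ∀ (A B : List Endpoint),
    (∀ i < 2 * n, ∀ j < 2 * n, c i = c j → i = j) →
    Rel2kXi k (A ++ arc c 1 s n ++ arc c 0 s n ++ B)
      (A ++ shells c (fun i => decide (i % 2 = 1)) s n ++ B) := by
  induction n with
  | zero => intro A B _; simpa [shells, arc] using rel_refl k _
  | succ n ih =>
    intro A B hinj
    have hne : ∀ i < 2 * (n + 1), ∀ j < 2 * (n + 1), i ≠ j → c i ≠ c j :=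
      fun i hi j hj hij e => hij (hinj i hi j hj e)
    have hfr : ∀ i, 2 * n ≤ i → i < 2 * (n + 1) → c i ∉ labels (arc c 0 s n) := by
      intro i hi hi' hm
      obtain ⟨j, hj, e⟩ := mem_labels_arc c 0 s n _ hm
      exact hne i hi' j (by omega) (by omega) e
    have h1 := rel_block k (Endpoint.mk (c (2 * n)) (decide (0 = 1)) s)
      (Endpoint.mk (c (2 * n + 1)) (decide (1 = 1)) s)
      (hne _ (by omega) _ (by omega) (by omega)) n (A ++ arc c 1 s n) (arc c 0 s n)
      ([Endpoint.mk (c (2 * n)) (decide (0 = 0)) s,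
        Endpoint.mk (c (2 * n + 1)) (decide (1 = 0)) s] ++ B)
      (by simp [arc]) (hfr _ (by omega) (by omega)) (hfr _ (by omega) (by omega))
    have h2 := ih A (shellPair (c (2 * n)) (c (2 * n + 1)) false true s ++ B)
      (fun i hi j hj => hinj i (by omega) j (by omega))
    have e1 : (2 * n + 1) % 2 = 1 := by omega
    rw [arc_succ, arc_succ, shells_succ]
    simp [shellPair, e1] at h1 h2 ⊢
    exact rel_trans h1 h2

theorem even_length_of_isGaussDiagram (L : List Endpoint) (h : IsGaussDiagram L) :
    L.length % 2 = 0 := by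
  have h1 : ∑ x ∈ (labels L).toFinset, (labels L).count x = (labels L).length :=
    List.sum_toFinset_count_eq_length (labels L)
  have h2 : ∀ x ∈ (labels L).toFinset, (labels L).count x = 2 := by
    intro x hx
    simp only [labels, List.mem_toFinset, List.mem_map] at hx
    obtain ⟨e, he, rfl⟩ := hx
    have := (h e he).1
    rw [← this, labels, List.count, List.countP_map, List.countP_eq_length_filter]
    rfl
  rw [Finset.sum_congr rfl h2] at h1
  simp [labels] at h1
  omega

end Gauss

open Gauss in
/-- adding or removing `k` consecutive shell-pairs of the same
sign is realized by 2k-moves, Ξ-moves and Reidemeister moves. -/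
theorem rel2kXi_of_consecutive_shellPairs (k : ℕ) (hk : 0 < k)
    (G G' A B : List Endpoint) (c : ℕ → ℕ) (t : ℕ → Bool) (s : Bool)
    (hinj : ∀ i < 2 * k, ∀ j < 2 * k, c i = c j → i = j)
    (hfresh : ∀ i < 2 * k, c i ∉ labels (A ++ B))
    (hG : G = A ++ ((List.range k).map (fun i =>
        shellPair (c (2 * i)) (c (2 * i + 1)) (t (2 * i)) (t (2 * i + 1)) s)).flatten ++ B)
    (hG' : G' = A ++ B)
    (hvalid : IsGaussDiagram G) :
    Rel2kXi k G G' := by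
  have hA : ∀ i < 2 * k, c i ∉ labels A := fun i hi hm => hfresh i hi (by
    simp only [labels, List.map_append, List.mem_append] at hm ⊢; exact Or.inl hm)
  have hB : ∀ i < 2 * k, c i ∉ labels B := fun i hi hm => hfresh i hi (by
    simp only [labels, List.map_append, List.mem_append] at hm ⊢; exact Or.inr hm)
  have hG2 : G = A ++ shells c t s k ++ B := hG
  have hpar : (A.length + B.length) % 2 = 0 := by
    have h := even_length_of_isGaussDiagram G hvalid
    rw [hG2, List.length_append, List.length_append, length_shells] at h
    omega
  have h1 := rel_shells k c t (fun i => decide (i % 2 = 1)) s k A B hinj hA hB hpar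
  have h2 := rel_symm (rel_arcs k c s k A B hinj)
  have h3 : Rel2kXi k (A ++ arc c 1 s k ++ arc c 0 s k ++ B) (A ++ B) := by
    refine rel_of_step (Or.inr (Or.inl ⟨A, [], B, c, s, hinj, ?_, ?_, ?_⟩))
    · simpa using hfresh
    · simp [arc]
    · simp
  rw [hG2, hG']
  exact rel_trans h1 (rel_trans h2 h3)
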